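/- (Corollary 3.1.) Let P = A_0 + A_1 D (A_1 invertible) and Q = Σ_{j=0}^n B_j D^j be MODOs over M_ℓ(K), N = −A_1^{−1}A_0. Let Σ be a differential field extension of K with field of constants C_Σ, and let Ψ ∈ M_ℓ(Σ) be invertible with Ψ′ = N·Ψ; assume that Q maps every solution of Y′ = NY in Σ^ℓ to a solution of Y′ = NY. Then: (i) the system P(Y) = 0, Q(Y) = 0 has a nonzero solution in Σ^ℓ if and only if DRes(P,Q) = 0; and (ii) a vector ψ ∈ Σ^ℓ with P(ψ) = 0 satisfies Q(ψ) = 0 if and only if M(P,Q)·ψ = 0. -/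

import Mathlib

open Matrix Polynomial Finset

/-- A derivation-like map on a commutative ring: additive and satisfying the Leibniz rule. -/
def IsDeriv {R : Type*} [CommRing R] (d : R → R) : Prop :=
  (∀ a b, d (a + b) = d a + d b) ∧ (∀ a b, d (a * b) = d a * b + a * d b)

/-- The recursively defined matrices `p_j(N)`:
`p_0(N) = 1`, `p_{j+1}(N) = p_j(N) * N + (p_j(N))'`. -/
def pMat {R : Type*} [CommRing R] (d : R → R) {l : ℕ}
    (N : Matrix (Fin l) (Fin l) R) : ℕ → Matrix (Fin l) (Fin l) R
  | 0 => 1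
  | j + 1 => pMat d N j * N + (pMat d N j).map d

/-- Entrywise derivative of a vector. -/
def dVec {R : Type*} (d : R → R) {l : ℕ} (v : Fin l → R) : Fin l → R :=
  fun i => d (v i)

/-- Entrywise derivative of a matrix. -/
def dMat {R : Type*} (d : R → R) {l : ℕ} (A : Matrix (Fin l) (Fin l) R) :
    Matrix (Fin l) (Fin l) R :=
  A.map d

/-- Action of the first-order operator `P = A₀ + A₁ D` on vectors with entries in a
differential extension `E` of `K` (with embedding `ι` and derivation `dE`). -/
def opP {K E : Type*} [CommRing K] [CommRing E] (ι : K →+* E) (dE : E → E) {l : ℕ}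
    (A0 A1 : Matrix (Fin l) (Fin l) K) (ψ : Fin l → E) : Fin l → E :=
  (A0.map ι).mulVec ψ + (A1.map ι).mulVec (dVec dE ψ)

/-- Action of the operator `Q = Σ_{j=0}^n B_j D^j` on vectors with entries in a
differential extension `E` of `K`. -/
def opQ {K E : Type*} [CommRing K] [CommRing E] (ι : K →+* E) (dE : E → E) {l : ℕ}
    (n : ℕ) (Bc : ℕ → Matrix (Fin l) (Fin l) K) (ψ : Fin l → E) : Fin l → E :=
  ∑ j ∈ Finset.range (n + 1), ((Bc j).map ι).mulVec ((dVec dE)^[j] ψ)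

/-- Columnwise action of `Q = Σ_{j=0}^n B_j D^j` on matrices. -/
def opQMat {K E : Type*} [CommRing K] [CommRing E] (ι : K →+* E) (dE : E → E) {l : ℕ}
    (n : ℕ) (Bc : ℕ → Matrix (Fin l) (Fin l) K) (Ψ : Matrix (Fin l) (Fin l) E) :
    Matrix (Fin l) (Fin l) E :=
  ∑ j ∈ Finset.range (n + 1), (Bc j).map ι * (dMat dE)^[j] Ψ

/-- The matrix `M(P,Q) = Σ_{j=0}^n B_j p_j(N)` with `N = -A₁⁻¹A₀`. -/
noncomputable def MPQ {K : Type*} [Field K] (dK : K → K) {l : ℕ}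
    (n : ℕ) (A0 A1 : Matrix (Fin l) (Fin l) K) (Bc : ℕ → Matrix (Fin l) (Fin l) K) :
    Matrix (Fin l) (Fin l) K :=
  ∑ j ∈ Finset.range (n + 1), Bc j * pMat dK (-(A1⁻¹ * A0)) j

/-- Coefficientwise extension of a derivation to polynomials (the variable is a constant). -/
noncomputable def dPoly {K : Type*} [CommRing K] (d : K → K) (p : Polynomial K) : Polynomial K :=
  p.sum fun n a => Polynomial.C (d a) * Polynomial.X ^ n

/-- `N_λ = -A₁⁻¹ (A₀ - λ·1)` as a matrix over `K[λ]`. -/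
noncomputable def Nlam {K : Type*} [Field K] {l : ℕ} (A0 A1 : Matrix (Fin l) (Fin l) K) :
    Matrix (Fin l) (Fin l) (Polynomial K) :=
  -((A1⁻¹).map (Polynomial.C : K →+* Polynomial K) *
      (A0.map (Polynomial.C : K →+* Polynomial K)
        - (Polynomial.X : Polynomial K) • (1 : Matrix (Fin l) (Fin l) (Polynomial K))))

/-- `M(L-λ, B-μ) = Σ_{j=0}^n B_j p_j(N_λ) - μ·1` as a matrix over `K[λ][μ]`
(inner variable `λ`, outer variable `μ`). -/
noncomputable def Mspec {K : Type*} [Field K] (dK : K → K) {l : ℕ}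
    (n : ℕ) (A0 A1 : Matrix (Fin l) (Fin l) K) (Bc : ℕ → Matrix (Fin l) (Fin l) K) :
    Matrix (Fin l) (Fin l) (Polynomial (Polynomial K)) :=
  (∑ j ∈ Finset.range (n + 1),
      (Bc j).map (Polynomial.C.comp Polynomial.C : K →+* Polynomial (Polynomial K)) *
        (pMat (dPoly dK) (Nlam A0 A1) j).map
          (Polynomial.C : Polynomial K →+* Polynomial (Polynomial K)))
    - (Polynomial.X : Polynomial (Polynomial K)) •
        (1 : Matrix (Fin l) (Fin l) (Polynomial (Polynomial K)))

/-- The differential resultant `f(λ,μ) = det M(L-λ, B-μ)` as an element of `K[λ][μ]`. -/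
noncomputable def fSpec {K : Type*} [Field K] (dK : K → K) {l : ℕ}
    (n : ℕ) (A0 A1 : Matrix (Fin l) (Fin l) K) (Bc : ℕ → Matrix (Fin l) (Fin l) K) :
    Polynomial (Polynomial K) :=
  (Mspec dK n A0 A1 Bc).det

/-- Evaluation `K[λ][μ] → E` at `λ = a`, `μ = b` (through `ι : K →+* E`). -/
noncomputable def evalLM {K E : Type*} [CommRing K] [CommRing E] (ι : K →+* E) (a b : E) :
    Polynomial (Polynomial K) →+* E :=
  Polynomial.eval₂RingHom (Polynomial.eval₂RingHom ι a) b

/-- `N_λ` with `λ` specialized to an element `lam` of an extension `E`. -/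
noncomputable def NlamE {K E : Type*} [Field K] [CommRing E] (ι : K →+* E) (lam : E) {l : ℕ}
    (A0 A1 : Matrix (Fin l) (Fin l) K) : Matrix (Fin l) (Fin l) E :=
  -((A1⁻¹).map ι * (A0.map ι - lam • 1))

/-- `g(L,B)` applied to `ψ`, for `g` a polynomial in two variables over `C₀`
(inner variable `λ` substituted by `Lh`, outer variable `μ` substituted by `Bh`). -/
noncomputable def applyPoly {C₀ E : Type*} [CommRing C₀] [CommRing E] (ιc : C₀ →+* E) {l : ℕ}
    (Lh Bh : (Fin l → E) → (Fin l → E)) (g : Polynomial (Polynomial C₀)) (ψ : Fin l → E) :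
    Fin l → E :=
  ∑ i ∈ Finset.range (g.natDegree + 1),
    ∑ k ∈ Finset.range ((g.coeff i).natDegree + 1),
      ιc ((g.coeff i).coeff k) • Lh^[k] (Bh^[i] ψ)

theorem hx_d0 {R : Type*} [CommRing R] {d : R → R} (h : IsDeriv d) : d 0 = 0 := by
  have := h.1 0 0
  simpa using this

theorem hx_d1 {R : Type*} [CommRing R] {d : R → R} (h : IsDeriv d) : d 1 = 0 := by
  have := h.2 1 1
  simpa using this

theorem hx_dsum {R : Type*} [CommRing R] {d : R → R} (h : IsDeriv d) {α : Type*}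
    (s : Finset α) (f : α → R) : d (∑ i ∈ s, f i) = ∑ i ∈ s, d (f i) :=
  map_sum (AddMonoidHom.mk' d h.1) f s

theorem hx_dmulVec {R : Type*} [CommRing R] {d : R → R} (h : IsDeriv d) {l : ℕ}
    (A : Matrix (Fin l) (Fin l) R) (v : Fin l → R) :
    dVec d (A.mulVec v) = (A.map d).mulVec v + A.mulVec (dVec d v) := by
  funext i
  simp only [dVec, Matrix.mulVec, dotProduct, Pi.add_apply, Matrix.map_apply]
  rw [hx_dsum h, ← Finset.sum_add_distrib]
  exact Finset.sum_congr rfl fun j _ => h.2 _ _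

theorem hx_iter {K S : Type*} [Field K] [Field S] (dK : K → K) {dS : S → S}
    (hdS : IsDeriv dS) (ι : K →+* S) (hcomp : ∀ a : K, dS (ι a) = ι (dK a)) {l : ℕ}
    (N : Matrix (Fin l) (Fin l) K) (ψ : Fin l → S)
    (hψ : dVec dS ψ = (N.map ι).mulVec ψ) (j : ℕ) :
    (dVec dS)^[j] ψ = ((pMat dK N j).map ι).mulVec ψ := by
  induction j with
  | zero => simp [pMat]
  | succ j ih =>
    rw [Function.iterate_succ_apply', ih, hx_dmulVec hdS, hψ, Matrix.mulVec_mulVec, ← Matrix.map_mul,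
      ← Matrix.add_mulVec]
    congr 1
    ext a b
    simp [pMat, hcomp, add_comm, -Matrix.map_mul, Matrix.mul_apply]

theorem hx_opQ {K S : Type*} [Field K] [Field S] (dK : K → K) {dS : S → S}
    (hdS : IsDeriv dS) (ι : K →+* S) (hcomp : ∀ a : K, dS (ι a) = ι (dK a)) {l : ℕ}
    (A0 A1 : Matrix (Fin l) (Fin l) K) (n : ℕ) (Bc : ℕ → Matrix (Fin l) (Fin l) K) (ψ : Fin l → S)
    (hψ : dVec dS ψ = ((-(A1⁻¹ * A0)).map ι).mulVec ψ) :
    opQ ι dS n Bc ψ = ((MPQ dK n A0 A1 Bc).map ι).mulVec ψ := by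
  have : (MPQ dK n A0 A1 Bc).map ι = ∑ j ∈ Finset.range (n + 1),
      (Bc j).map ι * (pMat dK (-(A1⁻¹ * A0)) j).map ι := by
    unfold MPQ
    rw [← RingHom.mapMatrix_apply, map_sum]
    simp
  rw [this, Matrix.sum_mulVec, opQ]
  refine Finset.sum_congr rfl fun j _ => ?_
  rw [hx_iter dK hdS ι hcomp _ ψ hψ j, Matrix.mulVec_mulVec]

theorem hx_opP {K S : Type*} [Field K] [Field S] (dS : S → S)
    (ι : K →+* S) {l : ℕ}
    (A0 A1 : Matrix (Fin l) (Fin l) K) (hA1 : IsUnit A1.det) (ψ : Fin l → S) :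
    opP ι dS A0 A1 ψ = 0 ↔ dVec dS ψ = ((-(A1⁻¹ * A0)).map ι).mulVec ψ := by
  have h1 : (A1⁻¹).map ι * A1.map ι = 1 := by
    rw [← Matrix.map_mul, Matrix.nonsing_inv_mul _ hA1]; simp
  have h2 : A1.map ι * (A1⁻¹).map ι = 1 := by
    rw [← Matrix.map_mul, Matrix.mul_nonsing_inv _ hA1]; simp
  have h3 : (-(A1⁻¹ * A0)).map ι = -((A1⁻¹).map ι * A0.map ι) := by
    rw [← Matrix.map_mul]; ext; simp [-Matrix.map_mul]
  rw [h3, opP, Matrix.neg_mulVec, ← Matrix.mulVec_mulVec]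
  constructor
  · intro h
    have := congrArg ((A1⁻¹).map ι).mulVec h
    rw [Matrix.mulVec_add, Matrix.mulVec_mulVec _ _ (A1.map ι), h1] at this
    simp only [Matrix.one_mulVec, Matrix.mulVec_zero] at this
    exact eq_neg_of_add_eq_zero_right this
  · intro h
    rw [h, Matrix.mulVec_neg, Matrix.mulVec_mulVec, h2]
    simp

/-- field of constants -/
def hxConst {S : Type*} [Field S] (d : S → S) (h : IsDeriv d) : Subfield S where
  carrier := {a | d a = 0}
  mul_mem' := by
    intro a b ha hb
    simp only [Set.mem_ofPred_eq] at *
    rw [h.2, ha, hb]; simp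
  one_mem' := hx_d1 h
  add_mem' := by
    intro a b ha hb
    simp only [Set.mem_ofPred_eq] at *
    rw [h.1, ha, hb]; simp
  zero_mem' := hx_d0 h
  neg_mem' := by
    intro a ha
    simp only [Set.mem_ofPred_eq] at *
    have := h.1 a (-a)
    rw [add_neg_cancel, hx_d0 h, ha, zero_add] at this
    exact this.symm
  inv_mem' := by
    intro a ha
    simp only [Set.mem_ofPred_eq] at *
    by_cases h0 : a = 0
    · rw [h0, _root_.inv_zero, hx_d0 h]
    have := h.2 a a⁻¹
    rw [mul_inv_cancel₀ h0, hx_d1 h, ha, zero_mul, zero_add] at this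
    exact (mul_eq_zero.mp this.symm).resolve_left h0

theorem hx_const_kernel {S : Type*} [Field S] (d : S → S) (h : IsDeriv d) {l : ℕ}
    (C : Matrix (Fin l) (Fin l) S) (hC : C.map d = 0) (hdet : C.det = 0) :
    ∃ v : Fin l → S, v ≠ 0 ∧ dVec d v = 0 ∧ C.mulVec v = 0 := by
  let F := hxConst d h
  let C' : Matrix (Fin l) (Fin l) F := fun i j => ⟨C i j, congrFun (congrFun hC i) j⟩
  have hCC : C'.map F.subtype = C := rfl
  have hd : C'.det = 0 := by
    apply F.subtype.injective
    rw [RingHom.map_det, RingHom.mapMatrix_apply, hCC, hdet, map_zero]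
  obtain ⟨v, hv, hv0⟩ := Matrix.exists_mulVec_eq_zero_iff.mpr hd
  refine ⟨fun i => (v i : S), ?_, ?_, ?_⟩
  · intro h0
    apply hv
    funext i
    exact Subtype.ext (congrFun h0 i)
  · funext i
    exact (v i).2
  · funext i
    have := congrArg F.subtype (congrFun hv0 i)
    rw [RingHom.map_mulVec] at this
    rw [Pi.zero_apply, map_zero] at this
    exact this

/-- Corollary 3.1: existence of nonzero common solutions is equivalent to the
vanishing of the differential resultant, and within the solution space of `P` the solutions
of `Q` are cut out by `M(P,Q) Y = 0`. -/
theorem statement5 {K S : Type*} [Field K] [Field S] [CharZero K]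
    (dK : K → K) (hdK : IsDeriv dK) (dS : S → S) (hdS : IsDeriv dS)
    (ι : K →+* S) (hcomp : ∀ a : K, dS (ι a) = ι (dK a))
    {l : ℕ} (hl : 1 ≤ l)
    (A0 A1 : Matrix (Fin l) (Fin l) K) (hA1 : IsUnit A1.det)
    (n : ℕ) (hn : 1 ≤ n) (Bc : ℕ → Matrix (Fin l) (Fin l) K)
    (Ψ : Matrix (Fin l) (Fin l) S) (hΨu : IsUnit Ψ.det)
    (hΨ : dMat dS Ψ = (-(A1⁻¹ * A0)).map ι * Ψ)
    (hclosed : ∀ ψ : Fin l → S, dVec dS ψ = ((-(A1⁻¹ * A0)).map ι).mulVec ψ →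
      dVec dS (opQ ι dS n Bc ψ) = ((-(A1⁻¹ * A0)).map ι).mulVec (opQ ι dS n Bc ψ)) :
    ((∃ ψ : Fin l → S, ψ ≠ 0 ∧ opP ι dS A0 A1 ψ = 0 ∧ opQ ι dS n Bc ψ = 0)
      ↔ (MPQ dK n A0 A1 Bc).det = 0)
    ∧ ∀ ψ : Fin l → S, opP ι dS A0 A1 ψ = 0 →
        (opQ ι dS n Bc ψ = 0 ↔ ((MPQ dK n A0 A1 Bc).map ι).mulVec ψ = 0) := by
  have hP := hx_opP dS ι A0 A1 hA1
  have hQ := hx_opQ dK hdS ι hcomp A0 A1 n Bc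
  refine ⟨⟨?_, ?_⟩, ?_⟩
  · rintro ⟨ψ, h0, h1, h2⟩
    rw [hQ ψ ((hP ψ).1 h1)] at h2
    have := Matrix.exists_mulVec_eq_zero_iff.mp ⟨ψ, h0, h2⟩
    apply ι.injective
    rw [RingHom.map_det, RingHom.mapMatrix_apply, this, map_zero]
  · intro hdet
    set N := (-(A1⁻¹ * A0)).map ι with hN
    set M := (MPQ dK n A0 A1 Bc).map ι with hM
    have hMdet : M.det = 0 := by
      rw [hM, ← RingHom.mapMatrix_apply, ← RingHom.map_det, hdet, map_zero]
    have hcol : ∀ k, dVec dS (fun i => Ψ i k) = N.mulVec (fun i => Ψ i k) := by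
      intro k
      funext i
      exact congrFun (congrFun hΨ i) k
    have hMΨ : (M * Ψ).map dS = N * (M * Ψ) := by
      ext i k
      have := hclosed _ (hcol k)
      rw [hQ _ (hcol k)] at this
      exact congrFun this i
    let C := Ψ⁻¹ * (M * Ψ)
    have hC : Ψ * C = M * Ψ := by
      simp only [C]
      rw [← Matrix.mul_assoc, Matrix.mul_nonsing_inv _ hΨu, Matrix.one_mul]
    have hmul : (Ψ * C).map dS = Ψ.map dS * C + Ψ * C.map dS := by
      ext i k
      exact congrFun (hx_dmulVec hdS Ψ (fun j => C j k)) i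
    have hΨC : Ψ * C.map dS = 0 := by
      rw [hC, hMΨ, show Ψ.map dS = N * Ψ from hΨ, Matrix.mul_assoc, hC] at hmul
      exact left_eq_add.mp hmul
    have hC0 : C.map dS = 0 := by
      have := congrArg (Ψ⁻¹ * ·) hΨC
      simpa [← Matrix.mul_assoc, Matrix.nonsing_inv_mul _ hΨu] using this
    have hCdet : C.det = 0 := by
      simp [C, hMdet]
    obtain ⟨v, hv, hdv, hCv⟩ := hx_const_kernel dS hdS C hC0 hCdet
    have hsol : dVec dS (Ψ.mulVec v) = N.mulVec (Ψ.mulVec v) := by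
      rw [hx_dmulVec hdS, hdv, show Ψ.map dS = N * Ψ from hΨ, Matrix.mulVec_mulVec]
      simp
    refine ⟨Ψ.mulVec v, ?_, (hP _).2 hsol, ?_⟩
    · intro h0
      apply hv
      have := congrArg (Ψ⁻¹).mulVec h0
      simpa [Matrix.mulVec_mulVec, Matrix.nonsing_inv_mul _ hΨu] using this
    · rw [hQ _ hsol, Matrix.mulVec_mulVec, ← hC, ← Matrix.mulVec_mulVec, hCv, Matrix.mulVec_zero]
  · intro ψ h
    rw [hQ ψ ((hP ψ).1 h)]
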